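/- arXiv:2503.15585 — 8 statements merged into one kernel-verified Lean document; each statement's English description precedes it below -/
import Mathlib

section
/- Let C be a category with an (E,M)-factorization system and F : C → D a functor. Suppose p1 : X → F Y1 and p2 : X → F Y2 are F-precise with respect to M, g : Y1 → Z and h : Y2 → Z belong to M, and F g ∘ p1 = F h ∘ p2. Then every morphism d : Y1 → Y2 satisfying h ∘ d = g and F d ∘ p1 = p2 is an isomorphism. In particular, precise factorizations are unique up to isomorphism. -/
open CategoryTheory

universe v u v₂ u₂

/-- An (E,M)-factorization system on a category `C`: classes `E` and `M` of morphisms,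
each closed under composition and containing all isomorphisms, such that every morphism
factors as an `E`-morphism followed by an `M`-morphism, and every commutative square
with an `E`-morphism on the left and an `M`-morphism on the right has a unique diagonal. -/
structure FactorizationSystem (C : Type u) [Category.{v} C] where
  E : MorphismProperty C
  M : MorphismProperty C
  E_comp : ∀ {X Y Z : C} (f : X ⟶ Y) (g : Y ⟶ Z), E f → E g → E (f ≫ g)
  M_comp : ∀ {X Y Z : C} (f : X ⟶ Y) (g : Y ⟶ Z), M f → M g → M (f ≫ g)
  E_iso : ∀ {X Y : C} (f : X ⟶ Y), IsIso f → E f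
  M_iso : ∀ {X Y : C} (f : X ⟶ Y), IsIso f → M f
  factor : ∀ {X Y : C} (f : X ⟶ Y), ∃ (Z : C) (e : X ⟶ Z) (m : Z ⟶ Y), E e ∧ M m ∧ e ≫ m = f
  diagonal : ∀ {A B X Y : C} (e : A ⟶ B) (m : X ⟶ Y) (f : A ⟶ X) (g : B ⟶ Y),
    E e → M m → e ≫ g = f ≫ m → ∃! d : B ⟶ X, e ≫ d = f ∧ d ≫ m = g

/-- A morphism `p : P ⟶ F R` is `F`-precise with respect to a class `M` of morphisms of `C`:
for every `f : P ⟶ F C'` and `m : R ⟶ D'`, `h : C' ⟶ D'` in `M` with `F m ∘ p = F h ∘ f`,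
there is `d : R ⟶ C'` with `F d ∘ p = f` and `h ∘ d = m`. -/
def IsPrecise {C : Type u} [Category.{v} C] {D : Type u₂} [Category.{v₂} D]
    (F : C ⥤ D) (M : MorphismProperty C) {P : D} {R : C} (p : P ⟶ F.obj R) : Prop :=
  ∀ ⦃C' D' : C⦄ (f : P ⟶ F.obj C') (m : R ⟶ D') (h : C' ⟶ D'),
    M m → M h → p ≫ F.map m = f ≫ F.map h →
    ∃ d : R ⟶ C', p ≫ F.map d = f ∧ d ≫ h = m

/-- The right class of a factorization system is left-cancellable. -/
theorem FactorizationSystem.M_of_comp {C : Type u} [Category.{v} C]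
    (FS : FactorizationSystem C) {X Y Z : C} (f : X ⟶ Y) (g : Y ⟶ Z)
    (hg : FS.M g) (hfg : FS.M (f ≫ g)) : FS.M f := by
  obtain ⟨W, e, m, he, hm, rfl⟩ := FS.factor f
  obtain ⟨k, ⟨hek, hkg⟩, -⟩ :=
    FS.diagonal e ((e ≫ m) ≫ g) (𝟙 X) (m ≫ g) he hfg (by simp)
  have hke : k ≫ e = 𝟙 W :=
    (FS.diagonal e (m ≫ g) e (m ≫ g) he (FS.M_comp m g hm hg) rfl).unique
      ⟨by rw [← Category.assoc, hek, Category.id_comp], by simpa using hkg⟩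
      ⟨Category.comp_id e, Category.id_comp _⟩
  exact FS.M_comp e m (FS.M_iso e ⟨k, hek, hke⟩) hm

/-- Precise factorizations are unique up to isomorphism: if `p₁` and `p₂` are `F`-precise,
`g, h ∈ M` and `F g ∘ p₁ = F h ∘ p₂`, then any morphism `d` with `h ∘ d = g` and
`F d ∘ p₁ = p₂` is an isomorphism. -/
theorem precise_factorization_unique
    {C : Type u} [Category.{v} C] {D : Type u₂} [Category.{v₂} D]
    (FS : FactorizationSystem C) (F : C ⥤ D)
    {X : D} {Y₁ Y₂ Z : C}
    (p₁ : X ⟶ F.obj Y₁) (p₂ : X ⟶ F.obj Y₂)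
    (hp₁ : IsPrecise F FS.M p₁) (hp₂ : IsPrecise F FS.M p₂)
    (g : Y₁ ⟶ Z) (h : Y₂ ⟶ Z) (hg : FS.M g) (hh : FS.M h)
    (hsq : p₁ ≫ F.map g = p₂ ≫ F.map h)
    (d : Y₁ ⟶ Y₂) (hd₁ : d ≫ h = g) (hd₂ : p₁ ≫ F.map d = p₂) :
    IsIso d := by
  have hd : FS.M d := FS.M_of_comp d h hh (hd₁.symm ▸ hg)
  obtain ⟨d', hd'₁, hd'₂⟩ :=
    hp₂ p₁ (𝟙 Y₂) d (FS.M_iso _ inferInstance) hd (by simp [hd₂])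
  have hd' : FS.M d' :=
    FS.M_of_comp d' d hd (hd'₂.symm ▸ FS.M_iso _ inferInstance)
  obtain ⟨d'', -, hd''⟩ :=
    hp₁ p₂ (𝟙 Y₁) d' (FS.M_iso _ inferInstance) hd' (by simp [hd'₁])
  have hdd : d'' = d := by
    rw [← Category.comp_id d'', ← hd'₂, ← Category.assoc, hd'', Category.id_comp]
  exact ⟨d', hdd ▸ hd'', hd'₂⟩
end

section
/- Let C be a category with an (E,M)-factorization system, suppose C has pullbacks of pairs of M-morphisms with common codomain, and let F : C → C preserve such pullbacks weakly (F maps these pullback squares to weak pullback squares). Then every pointed F-coalgebra has at most one M-reachable subcoalgebra: if g : R → C and h : S → C are pointed coalgebra homomorphisms whose underlying morphisms belong to M and the pointed coalgebras R and S are M-reachable, then there is an isomorphism of pointed coalgebras φ : R → S with h ∘ φ = g. -/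
open CategoryTheory Limits

universe v u

variable {C : Type u} [Category.{v} C]

/-- A pointed `F`-coalgebra: an object `X`, a structure map `X ⟶ F X`,
and a point `I ⟶ X`. -/
structure PtCoalg (F : C ⥤ C) (I : C) where
  X : C
  str : X ⟶ F.obj X
  pt : I ⟶ X

/-- A pointed coalgebra homomorphism: a morphism commuting with the structure maps
and preserving the point. -/
structure PtHom {F : C ⥤ C} {I : C} (A B : PtCoalg F I) where
  f : A.X ⟶ B.X
  comm : f ≫ B.str = A.str ≫ F.map f
  point : A.pt ≫ f = B.pt

/-- `h` is an isomorphism of pointed coalgebras: it has a two-sided inverse that is itself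
a pointed coalgebra homomorphism. -/
def PtHom.IsIsoHom {F : C ⥤ C} {I : C} {A B : PtCoalg F I} (h : PtHom A B) : Prop :=
  ∃ s : PtHom B A, h.f ≫ s.f = 𝟙 A.X ∧ s.f ≫ h.f = 𝟙 B.X

/-- A pointed coalgebra `B` is `M`-reachable if every pointed coalgebra homomorphism
into `B` whose underlying morphism is in `M` is a split epimorphism in the category of
pointed coalgebras. -/
def IsReachable {F : C ⥤ C} {I : C} (M : MorphismProperty C) (B : PtCoalg F I) : Prop :=
  ∀ (A : PtCoalg F I) (h : PtHom A B), M h.f → ∃ s : PtHom B A, s.f ≫ h.f = 𝟙 B.X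

/-- A pointed coalgebra `B` is a tree if every pointed coalgebra homomorphism into `B`
is a split epimorphism in the category of pointed coalgebras. -/
def IsTree {F : C ⥤ C} {I : C} (B : PtCoalg F I) : Prop :=
  ∀ (A : PtCoalg F I) (h : PtHom A B), ∃ s : PtHom B A, s.f ≫ h.f = 𝟙 B.X

namespace FactorizationSystem

/-- A morphism with the unique right lifting property against `E` belongs to `M`. -/
theorem M_of_unique_lifting (FS : FactorizationSystem C) {X Y : C} (m : X ⟶ Y)
    (hm : ∀ {A B : C} (e : A ⟶ B) (a : A ⟶ X) (b : B ⟶ Y), FS.E e → e ≫ b = a ≫ m →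
      ∃! d : B ⟶ X, e ≫ d = a ∧ d ≫ m = b) : FS.M m := by
  obtain ⟨Z, e, n, he, hn, rfl⟩ := FS.factor m
  obtain ⟨d, ⟨hd₁, hd₂⟩, -⟩ := hm e (𝟙 X) n he (by simp)
  have hde : d ≫ e = 𝟙 Z :=
    (FS.diagonal e n e n he hn rfl).unique ⟨by rw [reassoc_of% hd₁], by simpa using hd₂⟩
      ⟨by simp, by simp⟩
  exact FS.M_comp _ _ (FS.M_iso e ⟨d, hd₁, hde⟩) hn

/-- The class `M` is left cancellative. -/
theorem M_of_comp_s5 (FS : FactorizationSystem C) {X Y Z : C} (f : X ⟶ Y) (g : Y ⟶ Z)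
    (hg : FS.M g) (hfg : FS.M (f ≫ g)) : FS.M f := by
  refine FS.M_of_unique_lifting f fun {A B} e a b he hsq => ?_
  have hsq' : e ≫ b ≫ g = a ≫ f ≫ g := by rw [reassoc_of% hsq]
  obtain ⟨d, ⟨hd₁, hd₂⟩, hd⟩ := FS.diagonal e (f ≫ g) a (b ≫ g) he hfg hsq'
  refine ⟨d, ⟨hd₁, ?_⟩, fun d' ⟨h₁, h₂⟩ => hd d' ⟨h₁, by rw [reassoc_of% h₂]⟩⟩
  exact (FS.diagonal e g (a ≫ f) (b ≫ g) he hg (by simpa using hsq')).unique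
    ⟨by rw [reassoc_of% hd₁], by simpa using hd₂⟩ ⟨hsq, rfl⟩

/-- The class `M` is stable under pullback. -/
theorem M_fst_of_isPullback (FS : FactorizationSystem C) {P X Y Z : C} {p : P ⟶ X} {q : P ⟶ Y}
    {f : X ⟶ Z} {g : Y ⟶ Z} (h : IsPullback p q f g) (hg : FS.M g) : FS.M p := by
  refine FS.M_of_unique_lifting p fun {A B} e a b he hsq => ?_
  obtain ⟨d, ⟨hd₁, hd₂⟩, hd⟩ := FS.diagonal e g (a ≫ q) (b ≫ f) he hg
    (by rw [reassoc_of% hsq, h.w, Category.assoc])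
  refine ⟨h.lift b d hd₂.symm, ⟨h.hom_ext (by simp [hsq]) (by simp [hd₁]), by simp⟩, ?_⟩
  rintro d' ⟨h₁, h₂⟩
  refine h.hom_ext (by simp [h₂]) ?_
  simpa using hd (d' ≫ q) ⟨by rw [reassoc_of% h₁], by rw [Category.assoc, ← h.w, reassoc_of% h₂]⟩

end FactorizationSystem

/-- Composition of pointed coalgebra homomorphisms. -/
def PtHom.comp {F : C ⥤ C} {I : C} {A B D : PtCoalg F I} (h : PtHom A B) (k : PtHom B D) :
    PtHom A D where
  f := h.f ≫ k.f
  comm := by rw [Category.assoc, k.comm, ← Category.assoc, h.comm, Category.assoc, F.map_comp]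
  point := by rw [← Category.assoc, h.point, k.point]

/-- A pullback of coalgebra homomorphisms which `F` preserves weakly carries a pointed coalgebra
structure making both projections homomorphisms. -/
theorem PtHom.exists_coalgebra_of_isPullback {F : C ⥤ C} {I : C} {D R S : PtCoalg F I}
    (g : PtHom R D) (h : PtHom S D) {P : C} {p₁ : P ⟶ R.X} {p₂ : P ⟶ S.X}
    (hP : IsPullback p₁ p₂ g.f h.f)
    (hweak : ∀ {W : C} (a : W ⟶ F.obj R.X) (b : W ⟶ F.obj S.X), a ≫ F.map g.f = b ≫ F.map h.f →
      ∃ w : W ⟶ F.obj P, w ≫ F.map p₁ = a ∧ w ≫ F.map p₂ = b) :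
    ∃ (c : P ⟶ F.obj P) (i : I ⟶ P) (k₁ : PtHom ⟨P, c, i⟩ R) (k₂ : PtHom ⟨P, c, i⟩ S),
      k₁.f = p₁ ∧ k₂.f = p₂ := by
  obtain ⟨c, hc₁, hc₂⟩ := hweak (p₁ ≫ R.str) (p₂ ≫ S.str) (by
    rw [Category.assoc, Category.assoc, ← g.comm, ← h.comm, reassoc_of% hP.w])
  exact ⟨c, hP.lift R.pt S.pt (g.point.trans h.point.symm), ⟨p₁, hc₁.symm, by simp⟩,
    ⟨p₂, hc₂.symm, by simp⟩, rfl, rfl⟩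

/-- An `M`-carried homomorphism between `M`-reachable pointed coalgebras is an isomorphism. -/
theorem PtHom.isIsoHom_of_isReachable {F : C ⥤ C} {I : C} (FS : FactorizationSystem C)
    {R S : PtCoalg F I} (φ : PtHom R S) (hφ : FS.M φ.f)
    (hR : IsReachable FS.M R) (hS : IsReachable FS.M S) : φ.IsIsoHom := by
  obtain ⟨t, ht⟩ := hS R φ hφ
  have htM : FS.M t.f := FS.M_of_comp_s5 _ _ hφ (ht ▸ FS.M_iso _ inferInstance)
  obtain ⟨r, hr⟩ := hR S t htM
  have hrφ : r.f = φ.f := by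
    rw [← Category.comp_id r.f, ← ht, reassoc_of% hr]
  exact ⟨t, hrφ ▸ hr, ht⟩

/-- If `C` has pullbacks of pairs of `M`-morphisms with common codomain and `F` preserves
such pullbacks weakly, then every pointed coalgebra has at most one `M`-reachable
subcoalgebra: any two `M`-carried pointed coalgebra homomorphisms from `M`-reachable
pointed coalgebras into the same pointed coalgebra are related by a compatible isomorphism. -/
theorem reachable_subcoalgebra_unique
    {F : C ⥤ C} {I : C} (FS : FactorizationSystem C)
    (hpb : ∀ {A B Q : C} (f : A ⟶ Q) (g : B ⟶ Q), FS.M f → FS.M g →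
      ∃ (P : C) (p₁ : P ⟶ A) (p₂ : P ⟶ B), IsPullback p₁ p₂ f g)
    (hweak : ∀ {P A B Q : C} (p₁ : P ⟶ A) (p₂ : P ⟶ B) (f : A ⟶ Q) (g : B ⟶ Q),
      FS.M f → FS.M g → IsPullback p₁ p₂ f g →
      ∀ {W : C} (a : W ⟶ F.obj A) (b : W ⟶ F.obj B), a ≫ F.map f = b ≫ F.map g →
        ∃ w : W ⟶ F.obj P, w ≫ F.map p₁ = a ∧ w ≫ F.map p₂ = b)
    {D R S : PtCoalg F I} (g : PtHom R D) (h : PtHom S D)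
    (hg : FS.M g.f) (hh : FS.M h.f)
    (hR : IsReachable FS.M R) (hS : IsReachable FS.M S) :
    ∃ φ : PtHom R S, φ.IsIsoHom ∧ φ.f ≫ h.f = g.f := by
  obtain ⟨P, p₁, p₂, hP⟩ := hpb g.f h.f hg hh
  obtain ⟨c, i, k₁, k₂, rfl, rfl⟩ :=
    g.exists_coalgebra_of_isPullback h hP (hweak _ _ _ _ hg hh hP)
  obtain ⟨s, hs⟩ := hR _ k₁ (FS.M_fst_of_isPullback hP hh)
  have hφ : (s.comp k₂).f ≫ h.f = g.f := by
    simp only [PtHom.comp, Category.assoc]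
    rw [← hP.w, reassoc_of% hs]
  exact ⟨s.comp k₂, PtHom.isIsoHom_of_isReachable FS _ (FS.M_of_comp_s5 _ _ hh (hφ.symm ▸ hg)) hR hS,
    hφ⟩
end

section
/- Let C be a category with an (E,M)-factorization system such that M is a class of monomorphisms, and let F : C → C preserve M (F m ∈ M for every m ∈ M). Then a pointed F-coalgebra (C, c, i_C) is M-reachable if and only if the underlying morphism of every pointed coalgebra homomorphism h : (D, d, i_D) → (C, c, i_C) belongs to E. -/
open CategoryTheory Limits

universe v u

variable {C : Type u} [Category.{v} C]

/-- If `F` preserves `M`, the factorization system lifts to pointed coalgebras: every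
homomorphism factors through a homomorphism in `E` followed by one in `M`. -/
theorem PtHom.exists_factorization {F : C ⥤ C} {I : C} (FS : FactorizationSystem C)
    (hF : ∀ {X Y : C} (m : X ⟶ Y), FS.M m → FS.M (F.map m))
    {A B : PtCoalg F I} (h : PtHom A B) :
    ∃ (T : PtCoalg F I) (e : PtHom A T) (m : PtHom T B),
      FS.E e.f ∧ FS.M m.f ∧ e.f ≫ m.f = h.f := by
  obtain ⟨Z, e, m, he, hm, hem⟩ := FS.factor h.f
  obtain ⟨d, ⟨hd₁, hd₂⟩, -⟩ := FS.diagonal e (F.map m) (A.str ≫ F.map e) (m ≫ B.str) he (hF m hm)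
    (by rw [← Category.assoc, hem, h.comm, Category.assoc, ← F.map_comp, hem])
  exact ⟨⟨Z, d, A.pt ≫ e⟩, ⟨e, hd₁, rfl⟩,
    ⟨m, hd₂.symm, by rw [Category.assoc, hem, h.point]⟩, he, hm, hem⟩

/-- A two-sided inverse of the underlying morphism of a homomorphism is a homomorphism. -/
def PtHom.inverse {F : C ⥤ C} {I : C} {A B : PtCoalg F I} (h : PtHom A B) (d : B.X ⟶ A.X)
    (hd : h.f ≫ d = 𝟙 A.X) (dh : d ≫ h.f = 𝟙 B.X) : PtHom B A where
  f := d
  comm := by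
    have key : A.str = h.f ≫ B.str ≫ F.map d := by
      rw [← Category.assoc, h.comm, Category.assoc, ← F.map_comp, hd, F.map_id, Category.comp_id]
    rw [key, ← Category.assoc, dh, Category.id_comp]
  point := by rw [← h.point, Category.assoc, hd, Category.comp_id]

/-- If `M` consists of monomorphisms and `F` preserves `M`, then a pointed coalgebra is
`M`-reachable iff the underlying morphism of every pointed coalgebra homomorphism into it
belongs to `E`. -/
theorem reachable_iff_every_hom_in_E
    {F : C ⥤ C} {I : C} (FS : FactorizationSystem C)
    (hM : ∀ {X Y : C} (f : X ⟶ Y), FS.M f → Mono f)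
    (hF : ∀ {X Y : C} (m : X ⟶ Y), FS.M m → FS.M (F.map m))
    (B : PtCoalg F I) :
    IsReachable FS.M B ↔ ∀ (A : PtCoalg F I) (h : PtHom A B), FS.E h.f := by
  constructor
  · intro hB A h
    obtain ⟨T, e, m, he, hm, hem⟩ := h.exists_factorization FS hF
    obtain ⟨s, hs⟩ := hB T m hm
    have := hM m.f hm
    have : IsIso m.f :=
      ⟨s.f, by rw [← cancel_mono m.f, Category.assoc, hs, Category.comp_id, Category.id_comp], hs⟩
    exact hem ▸ FS.E_comp _ _ he (FS.E_iso m.f this)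
  · intro hE A h hm
    obtain ⟨d, ⟨hd, dh⟩, -⟩ := FS.diagonal h.f h.f (𝟙 _) (𝟙 _) (hE A h) hm (by simp)
    exact ⟨h.inverse d hd dh, dh⟩
end

section
/- Let C be a category with countable coproducts, F : C → C an endofunctor, and (C, c, i_C) a pointed F-coalgebra. Suppose given objects C_k (k ∈ ℕ), morphisms m_k : C_k → C, a morphism e_0 : I → C_0 with i_C = m_0 ∘ e_0, and morphisms c_k : C_k → F C_{k+1} satisfying c ∘ m_k = F m_{k+1} ∘ c_k for all k. Then the coproduct ∐_{k∈ℕ} C_k carries the F-coalgebra structure whose restriction along each coproduct injection in_k is F(in_{k+1}) ∘ c_k, with point in_0 ∘ e_0, and the copairing [m_k]_{k∈ℕ} : ∐_{k∈ℕ} C_k → C is a pointed coalgebra homomorphism from this pointed coalgebra to (C, c, i_C). -/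
open CategoryTheory Limits

universe v u

variable {C : Type u} [Category.{v} C]

/-- Given the data of the iterative reachability construction (levels `Ck`, morphisms
`m k : Ck k ⟶ A.X`, a factorization `A.pt = e0 ≫ m 0` and squares
`m k ≫ A.str = cs k ≫ F.map (m (k+1))`), the coproduct `∐ Ck` carries the coalgebra
structure whose restriction along each injection `in_k` is `F(in_{k+1}) ∘ cs k`, with
point `in_0 ∘ e0`, and the copairing `[m k]` is a pointed coalgebra homomorphism from
this pointed coalgebra to `A`. -/
theorem copairing_is_pointed_coalgebra_hom
    [HasColimitsOfShape (Discrete ℕ) C]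
    (F : C ⥤ C) (I : C) (A : PtCoalg F I)
    (Ck : ℕ → C) (m : ∀ k, Ck k ⟶ A.X) (e0 : I ⟶ Ck 0)
    (hpt : A.pt = e0 ≫ m 0)
    (cs : ∀ k, Ck k ⟶ F.obj (Ck (k + 1)))
    (hsq : ∀ k, m k ≫ A.str = cs k ≫ F.map (m (k + 1))) :
    ∃ hom : PtHom
        (⟨∐ Ck,
          Sigma.desc (fun k => cs k ≫ F.map (Sigma.ι Ck (k + 1))),
          e0 ≫ Sigma.ι Ck 0⟩ : PtCoalg F I)
        A,
      hom.f = Sigma.desc m := by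
  refine ⟨⟨Sigma.desc m, ?_, ?_⟩, rfl⟩
  · refine Sigma.hom_ext _ _ fun k => ?_
    simp [hsq, ← F.map_comp]
  · simp [hpt]
end

section
/- Let C be a category, F : C → C an endofunctor, and I an object of C. Every pointed coalgebra homomorphism h : (C, c, i_C) → (D, d, i_D) between pointed F-coalgebras that are trees is an isomorphism. -/
open CategoryTheory Limits

universe v u

variable {C : Type u} [Category.{v} C]

/-- Every pointed coalgebra homomorphism between trees is an isomorphism. -/
theorem hom_between_trees_isIso
    {F : C ⥤ C} {I : C} {A B : PtCoalg F I} (h : PtHom A B)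
    (hA : IsTree A) (hB : IsTree B) :
    h.IsIsoHom := by
  obtain ⟨s, hs⟩ := hB A h
  obtain ⟨t, ht⟩ := hA B s
  have hth : t.f = h.f := by
    rw [← Category.comp_id t.f, ← hs, ← Category.assoc, ht, Category.id_comp]
  exact ⟨s, hth ▸ ht, hs⟩
end

section
/- Let C be a category with pullbacks and F : C → C an endofunctor that preserves pullbacks weakly (F maps pullback squares to weak pullback squares). Then every pointed F-coalgebra has at most one tree unravelling: if g : R → C and h : S → C are pointed coalgebra homomorphisms and the pointed coalgebras R and S are trees, then there is an isomorphism of pointed coalgebras φ : R → S with h ∘ φ = g. -/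
open CategoryTheory Limits

universe v u

variable {C : Type u} [Category.{v} C]

/-- Every pointed coalgebra homomorphism between trees is an isomorphism. -/
theorem PtHom.isIsoHom_of_isTree {F : C ⥤ C} {I : C} {R S : PtCoalg F I}
    (hR : IsTree R) (hS : IsTree S) (φ : PtHom R S) : φ.IsIsoHom := by
  obtain ⟨t, ht⟩ := hS R φ
  obtain ⟨u, hu⟩ := hR S t
  have hφ : u.f = φ.f := by
    rw [← Category.comp_id u.f, ← ht, ← Category.assoc, hu, Category.id_comp]
  exact ⟨t, hφ ▸ hu, ht⟩

/-- If `C` has pullbacks and `F` preserves pullbacks weakly, then every pointed coalgebra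
has at most one tree unravelling: any two pointed coalgebra homomorphisms into it from
trees are related by a compatible isomorphism. -/
theorem tree_unravelling_unique
    [HasPullbacks C] {F : C ⥤ C} {I : C}
    (hweak : ∀ {P A B Q : C} (p₁ : P ⟶ A) (p₂ : P ⟶ B) (f : A ⟶ Q) (g : B ⟶ Q),
      IsPullback p₁ p₂ f g →
      ∀ {W : C} (a : W ⟶ F.obj A) (b : W ⟶ F.obj B), a ≫ F.map f = b ≫ F.map g →
        ∃ w : W ⟶ F.obj P, w ≫ F.map p₁ = a ∧ w ≫ F.map p₂ = b)
    {D R S : PtCoalg F I} (g : PtHom R D) (h : PtHom S D)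
    (hR : IsTree R) (hS : IsTree S) :
    ∃ φ : PtHom R S, φ.IsIsoHom ∧ φ.f ≫ h.f = g.f := by
  obtain ⟨w, hw₁, hw₂⟩ := hweak (pullback.fst g.f h.f) (pullback.snd g.f h.f) g.f h.f
    (IsPullback.of_hasPullback g.f h.f)
    (pullback.fst g.f h.f ≫ R.str) (pullback.snd g.f h.f ≫ S.str) (by
      rw [Category.assoc, Category.assoc, ← g.comm, ← h.comm, ← Category.assoc,
        ← Category.assoc, pullback.condition])
  let P : PtCoalg F I :=
    { X := pullback g.f h.f
      str := w
      pt := pullback.lift R.pt S.pt (by rw [g.point, h.point]) }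
  let p₁ : PtHom P R := ⟨pullback.fst g.f h.f, hw₁.symm, pullback.lift_fst _ _ _⟩
  let p₂ : PtHom P S := ⟨pullback.snd g.f h.f, hw₂.symm, pullback.lift_snd _ _ _⟩
  obtain ⟨s, hs⟩ := hR P p₁
  refine ⟨s.comp p₂, PtHom.isIsoHom_of_isTree hR hS _, ?_⟩
  calc (s.f ≫ p₂.f) ≫ h.f = s.f ≫ p₁.f ≫ g.f := by
        rw [Category.assoc]
        exact congrArg (s.f ≫ ·) pullback.condition.symm
    _ = g.f := by rw [← Category.assoc, hs, Category.id_comp]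
end

section
/- Fix an alphabet A and a pointed partial deterministic automaton (C, o, δ, q0). The coalgebra of defined inputs (P, ō, δ̄, ε) is a tree: for every pointed F-coalgebra (T, o_T, δ_T, t0), where F X = 2 × (X + {⊥})^A, and every pointed coalgebra homomorphism h : (T, o_T, δ_T, t0) → (P, ō, δ̄, ε), there exists a pointed coalgebra homomorphism s : (P, ō, δ̄, ε) → (T, o_T, δ_T, t0) with h ∘ s = id_P. -/
universe u v w

variable {A : Type u}

/-- The extension of a partial transition map `δ` to words: `deltaStar δ q w` is the
state reached from `q` by reading the word `w`, if defined. -/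
def deltaStar {C : Type v} (δ : C → A → Option C) (q : C) (w : List A) : Option C :=
  w.foldl (fun s a => s.bind (fun q' => δ q' a)) (some q)

/-- The set of defined inputs of a pointed partial deterministic automaton: the words on
which the extended transition map from the initial state is defined. -/
def Defined {C : Type v} (δ : C → A → Option C) (q0 : C) : Type u :=
  {w : List A // (deltaStar δ q0 w).isSome}

/-- The output function of the coalgebra of defined inputs. -/
def definedOut {C : Type v} (o : C → Bool) (δ : C → A → Option C) (q0 : C)
    (w : Defined δ q0) : Bool :=
  o ((deltaStar δ q0 w.1).get w.2)

/-- The transition function of the coalgebra of defined inputs. -/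
def definedTrans {C : Type v} (δ : C → A → Option C) (q0 : C)
    (w : Defined δ q0) (a : A) : Option (Defined δ q0) :=
  if h : (deltaStar δ q0 (w.1 ++ [a])).isSome then some ⟨w.1 ++ [a], h⟩ else none

/-- The point of the coalgebra of defined inputs: the empty word. -/
def definedPt {C : Type v} (δ : C → A → Option C) (q0 : C) : Defined δ q0 :=
  ⟨[], rfl⟩

theorem deltaStar_concat {C : Type v} (δ : C → A → Option C) (q : C) (w : List A) (a : A) :
    deltaStar δ q (w ++ [a]) = (deltaStar δ q w).bind (fun q' => δ q' a) := by
  simp [deltaStar]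

theorem definedTrans_of_isSome {C : Type v} (δ : C → A → Option C) (q0 : C)
    (w : Defined δ q0) (a : A) (hwa : (deltaStar δ q0 (w.1 ++ [a])).isSome) :
    definedTrans δ q0 w a = some ⟨w.1 ++ [a], hwa⟩ :=
  dif_pos hwa

theorem definedTrans_of_not_isSome {C : Type v} (δ : C → A → Option C) (q0 : C)
    (w : Defined δ q0) (a : A) (hwa : ¬ (deltaStar δ q0 (w.1 ++ [a])).isSome) :
    definedTrans δ q0 w a = none :=
  dif_neg hwa

/-- Every defined input `w` can be read in a coalgebra over the coalgebra of defined inputs,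
and the state reached lies over `w`. -/
theorem exists_deltaStar_eq_some_of_hom {C : Type v} (δ : C → A → Option C) (q0 : C)
    {T : Type w} (δT : T → A → Option T) (t0 : T) (h : T → Defined δ q0)
    (hTrans : ∀ x a, definedTrans δ q0 (h x) a = Option.map h (δT x a))
    (hPt : h t0 = definedPt δ q0) (w : List A) (hw : (deltaStar δ q0 w).isSome) :
    ∃ t, deltaStar δT t0 w = some t ∧ h t = ⟨w, hw⟩ := by
  induction w using List.reverseRecOn with
  | nil => exact ⟨t0, rfl, hPt⟩
  | append_singleton w a ih =>
    have hw' : (deltaStar δ q0 w).isSome := by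
      rw [deltaStar_concat] at hw
      exact Option.isSome_of_isSome_bind hw
    obtain ⟨t, ht, hht⟩ := ih hw'
    have hstep := hTrans t a
    rw [hht] at hstep
    obtain ⟨t', ht', hht'⟩ := Option.map_eq_some_iff.mp
      (hstep.symm.trans (definedTrans_of_isSome δ q0 ⟨w, hw'⟩ a hw))
    exact ⟨t', by rw [deltaStar_concat, ht, Option.bind_some, ht'], hht'⟩

/-- The coalgebra of defined inputs of a pointed partial deterministic automaton is a
tree: every pointed coalgebra homomorphism into it has a section that is itself a
pointed coalgebra homomorphism. -/
theorem defined_inputs_is_tree {C : Type v} (o : C → Bool) (δ : C → A → Option C) (q0 : C)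
    {T : Type w} (oT : T → Bool) (δT : T → A → Option T) (t0 : T)
    (h : T → Defined δ q0)
    (hOut : ∀ x, definedOut o δ q0 (h x) = oT x)
    (hTrans : ∀ x a, definedTrans δ q0 (h x) a = Option.map h (δT x a))
    (hPt : h t0 = definedPt δ q0) :
    ∃ s : Defined δ q0 → T,
      (∀ w, oT (s w) = definedOut o δ q0 w) ∧
      (∀ w a, δT (s w) a = Option.map s (definedTrans δ q0 w a)) ∧
      s (definedPt δ q0) = t0 ∧
      ∀ w, h (s w) = w := by
  choose s hs hsec using fun w : Defined δ q0 =>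
    exists_deltaStar_eq_some_of_hom δ q0 δT t0 h hTrans hPt w.1 w.2
  refine ⟨s, fun w => ?_, fun w a => ?_, ?_, hsec⟩
  · rw [← hOut, hsec]
    rfl
  · have hstep := hTrans (s w) a
    rw [hsec] at hstep
    change definedTrans δ q0 w a = _ at hstep
    by_cases hwa : (deltaStar δ q0 (w.1 ++ [a])).isSome
    · have hread := hs ⟨w.1 ++ [a], hwa⟩
      rw [deltaStar_concat, hs w, Option.bind_some] at hread
      rw [hread, definedTrans_of_isSome δ q0 w a hwa]
      rfl
    · rw [definedTrans_of_not_isSome δ q0 w a hwa] at hstep ⊢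
      exact Option.map_eq_none_iff.mp hstep.symm
  · exact (Option.some.inj (hs (definedPt δ q0))).symm
end

section
/- Let G = (V, E, s, t, v0) be a pointed directed multigraph in which every vertex has only finitely many outgoing edges. The coalgebra of rooted paths (Ē, d, ε) is a tree as a pointed coalgebra for the bag functor B: every pointed B-coalgebra homomorphism h : (R, r, i_R) → (Ē, d, ε) has a section s : (Ē, d, ε) → (R, r, i_R) that is itself a pointed B-coalgebra homomorphism with h ∘ s = id. -/
universe u v w

variable {V : Type u} {E : Type v}

/-- The target vertex of a (rooted) path given as a list of edges: the target of its
last edge, or the root `v0` for the empty path. -/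
def pathTrg (t : E → V) (v0 : V) (p : List E) : V :=
  (p.getLast?).elim v0 t

/-- `IsRPath s t v0 p` states that the list of edges `p` is a rooted path: a finite
sequence of consecutive edges starting at the root `v0`. -/
inductive IsRPath (s t : E → V) (v0 : V) : List E → Prop
  | nil : IsRPath s t v0 []
  | snoc {p : List E} {e : E} : IsRPath s t v0 p → s e = pathTrg t v0 p →
      IsRPath s t v0 (p ++ [e])

/-- The set of rooted paths of a pointed multigraph. -/
def RPath (s t : E → V) (v0 : V) : Type v :=
  {p : List E // IsRPath s t v0 p}

/-- The empty rooted path. -/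
def rpathNil (s t : E → V) (v0 : V) : RPath s t v0 :=
  ⟨[], IsRPath.nil⟩

/-- The coalgebra structure on rooted paths: `rpathStr p` is the multiset containing,
with multiplicity 1, each one-step extension of `p` by an edge starting at the target
of `p`. -/
def rpathStr (s t : E → V) (v0 : V) [∀ w : V, Fintype {e : E // s e = w}]
    (p : RPath s t v0) : Multiset (RPath s t v0) :=
  (Finset.univ : Finset {e : E // s e = pathTrg t v0 p.1}).val.map
    (fun e => ⟨p.1 ++ [e.1], IsRPath.snoc p.2 e.2⟩)

/-- The bag-coalgebra structure associated to a multigraph with finite out-degrees: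
`graphStr s t u` is the multiset of targets of the edges out of `u`, with
multiplicities. -/
def graphStr (s t : E → V) [∀ w : V, Fintype {e : E // s e = w}] (u : V) : Multiset V :=
  (Finset.univ : Finset {e : E // s e = u}).val.map (fun e => t e.1)

/-- The map sending each rooted path to its target vertex. -/
def rpathTarget (s t : E → V) (v0 : V) (p : RPath s t v0) : V :=
  pathTrg t v0 p.1

open Classical in
/-- A chosen `y ∈ l` with `f y = q`, or the default value `x` if there is none. -/
noncomputable def Multiset.liftAlong {α : Type*} {β : Type*} (f : α → β) (l : Multiset α)
    (x : α) (q : β) : α :=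
  if hq : ∃ y ∈ l, f y = q then hq.choose else x

theorem Multiset.liftAlong_spec {α : Type*} {β : Type*} {f : α → β} {l : Multiset α}
    {q : β} (x : α) (hq : q ∈ l.map f) : f (l.liftAlong f x q) = q := by
  have hq' : ∃ y ∈ l, f y = q := Multiset.mem_map.1 hq
  rw [Multiset.liftAlong, dif_pos hq']
  exact hq'.choose_spec.2

theorem Multiset.map_liftAlong {α : Type*} {β : Type*} {f : α → β} {l : Multiset α}
    (x : α) (hl : (l.map f).Nodup) : (l.map f).map (l.liftAlong f x) = l := by
  rw [Multiset.map_map]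
  refine (Multiset.map_congr rfl fun y hy => ?_).trans (Multiset.map_id l)
  have hy' : ∃ z ∈ l, f z = f y := ⟨y, hy, rfl⟩
  rw [Function.comp_apply, Multiset.liftAlong, dif_pos hy']
  exact Multiset.inj_on_of_nodup_map hl _ hy'.choose_spec.1 _ hy hy'.choose_spec.2

theorem rpathStr_map_val (s t : E → V) (v0 : V) [∀ w : V, Fintype {e : E // s e = w}]
    {α : Type*} (g : List E → α) (p : RPath s t v0) :
    (rpathStr s t v0 p).map (fun q => g q.1) =
      (Finset.univ : Finset {e : E // s e = pathTrg t v0 p.1}).val.map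
        (fun e => g (p.1 ++ [e.1])) :=
  Multiset.map_map _ _ _

theorem nodup_rpathStr_map_val (s t : E → V) (v0 : V)
    [∀ w : V, Fintype {e : E // s e = w}] (p : RPath s t v0) :
    ((rpathStr s t v0 p).map fun q => q.1).Nodup := by
  rw [rpathStr_map_val s t v0 (fun q => q)]
  refine Multiset.Nodup.map (fun a b hab => ?_) Finset.univ.nodup
  exact Subtype.ext (by simpa using hab)

/-- The coalgebra of rooted paths of a pointed multigraph with finite out-degrees is a
tree as a pointed coalgebra for the bag functor: every pointed bag-coalgebra
homomorphism into it has a section that is itself a pointed bag-coalgebra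
homomorphism. -/
theorem rooted_paths_is_tree (s t : E → V) (v0 : V)
    [∀ w : V, Fintype {e : E // s e = w}]
    {R : Type w} (r : R → Multiset R) (iR : R) (h : R → RPath s t v0)
    (hcoalg : ∀ x, rpathStr s t v0 (h x) = (r x).map h)
    (hpt : h iR = rpathNil s t v0) :
    ∃ sec : RPath s t v0 → R,
      (∀ p, r (sec p) = (rpathStr s t v0 p).map sec) ∧
      sec (rpathNil s t v0) = iR ∧
      ∀ p, h (sec p) = p := by
  have hval : ∀ x, ((rpathStr s t v0 (h x)).map fun q => q.1) = (r x).map fun y => (h y).1 := by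
    intro x
    rw [hcoalg]
    exact Multiset.map_map _ _ _
  let next : R → E → R := fun x e =>
    (r x).liftAlong (fun y => (h y).1) x ((h x).1 ++ [e])
  have hsec : ∀ p, IsRPath s t v0 p → (h (p.foldl next iR)).1 = p := by
    intro p hp
    induction hp with
    | nil => exact congrArg Subtype.val hpt
    | @snoc p e _ he ih =>
      rw [List.foldl_append]
      have key : (h (next (p.foldl next iR) e)).1 = (h (p.foldl next iR)).1 ++ [e] := by
        refine Multiset.liftAlong_spec (f := fun y => (h y).1) _ ?_
        rw [← hval, rpathStr_map_val s t v0 (fun q => q)]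
        exact Multiset.mem_map.2 ⟨⟨e, by rw [ih, he]⟩, Finset.mem_univ_val _, rfl⟩
      exact key.trans (by rw [ih])
  have hsec' : ∀ p : RPath s t v0, h (p.1.foldl next iR) = p :=
    fun p => Subtype.ext (hsec p.1 p.2)
  refine ⟨fun p => p.1.foldl next iR, fun p => ?_, rfl, hsec'⟩
  have hx := hsec' p
  have hnodup := nodup_rpathStr_map_val s t v0 (h (p.1.foldl next iR))
  rw [hval] at hnodup
  have hr := Multiset.map_liftAlong (p.1.foldl next iR) hnodup
  rw [← hval, hx, rpathStr_map_val s t v0 (fun q => q), Multiset.map_map] at hr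
  rw [rpathStr_map_val s t v0 (List.foldl next iR)]
  refine hr.symm.trans (Multiset.map_congr rfl fun e _ => ?_)
  simp only [Function.comp_apply, List.foldl_append, List.foldl_cons, List.foldl_nil, next, hx]
end
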